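/- (The vertex-based control law satisfies the contraction condition.) Let F ∈ ℝ^{p×n} with Ψ(z) = max_{1≤j≤p} F_{j,:}z, let A(w) = Σ_i w_i A_i, B(w) = Σ_i w_i B_i for w in the simplex W, fix a row index h, vertices x_1,…,x_V ∈ ℝⁿ with F_{h,:}x_v = max_j F_{j,:}x_v = 1 for every v, controls u_1,…,u_V ∈ ℝᵐ, and λ ∈ (0,1) such that Ψ(A(w)x_v + B(w)u_v) ≤ λ for all v and all w ∈ W. Then for every x = Σ_v γ_v x_v with γ_v ≥ 0 and u = Σ_v γ_v u_v, it holds that Ψ(A(w)x + B(w)u) ≤ λ Ψ(x) for all w ∈ W. -/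

import Mathlib

/-- The polyhedral gauge function `Ψ(z) = max_{1 ≤ j ≤ p} F_{j,:} z`. -/
noncomputable def gaugeFn {p n : ℕ} (F : Matrix (Fin p) (Fin n) ℝ) (z : Fin n → ℝ) : ℝ :=
  ⨆ j, F.mulVec z j

/-- The uncertainty simplex `W = {w ∈ ℝ^M | Σᵢ wᵢ = 1, w ≥ 0}`. -/
def simplexW (M : ℕ) : Set (Fin M → ℝ) := {w | ∑ i, w i = 1 ∧ ∀ i, 0 ≤ w i}

/-- The vertex-based control law satisfies the contraction condition: if the boundary
vertices `x_v` of a common facet sector (`F_{h,:} x_v = max_j F_{j,:} x_v = 1`) have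
feasible controls `u_v` with `Ψ(A(w) x_v + B(w) u_v) ≤ λ` for all `v` and `w ∈ W`,
then for every nonnegative combination `x = Σ_v γ_v x_v` with input `u = Σ_v γ_v u_v`,
`Ψ(A(w) x + B(w) u) ≤ λ Ψ(x)` for all `w ∈ W`. -/
theorem stmt14 {p n m M V : ℕ}
    (F : Matrix (Fin p) (Fin n) ℝ)
    (A : Fin M → Matrix (Fin n) (Fin n) ℝ) (B : Fin M → Matrix (Fin n) (Fin m) ℝ)
    (h : Fin p) (x : Fin V → (Fin n → ℝ)) (u : Fin V → (Fin m → ℝ))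
    (hvert : ∀ v, F.mulVec (x v) h = gaugeFn F (x v) ∧ F.mulVec (x v) h = 1)
    (lam : ℝ) (hlam0 : 0 < lam) (hlam1 : lam < 1)
    (hcontr : ∀ v, ∀ w ∈ simplexW M,
      gaugeFn F ((∑ i, w i • A i).mulVec (x v) + (∑ i, w i • B i).mulVec (u v)) ≤ lam) :
    ∀ γ : Fin V → ℝ, (∀ v, 0 ≤ γ v) → ∀ w ∈ simplexW M,
      gaugeFn F ((∑ i, w i • A i).mulVec (∑ v, γ v • x v)
          + (∑ i, w i • B i).mulVec (∑ v, γ v • u v))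
        ≤ lam * gaugeFn F (∑ v, γ v • x v) := by
  intro γ hγ w hw
  have le_gauge : ∀ (z : Fin n → ℝ) (j : Fin p), F.mulVec z j ≤ gaugeFn F z := fun z j =>
    le_ciSup (f := fun j => F.mulVec z j) (Set.finite_range _).bddAbove j
  have hx : F.mulVec (∑ v, γ v • x v) h = ∑ v, γ v := by
    rw [Matrix.mulVec_sum, Finset.sum_apply]
    refine Finset.sum_congr rfl fun v _ => ?_
    rw [Matrix.mulVec_smul, Pi.smul_apply, (hvert v).2, smul_eq_mul, mul_one]
  haveI : Nonempty (Fin p) := ⟨h⟩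
  have key : (∑ i, w i • A i).mulVec (∑ v, γ v • x v)
      + (∑ i, w i • B i).mulVec (∑ v, γ v • u v)
      = ∑ v, γ v • ((∑ i, w i • A i).mulVec (x v) + (∑ i, w i • B i).mulVec (u v)) := by
    simp only [Matrix.mulVec_sum, Matrix.mulVec_smul, smul_add, Finset.sum_add_distrib]
  rw [key]
  refine ciSup_le fun j => ?_
  calc _ = ∑ v, γ v * F.mulVec
        ((∑ i, w i • A i).mulVec (x v) + (∑ i, w i • B i).mulVec (u v)) j := by
        rw [Matrix.mulVec_sum, Finset.sum_apply]
        refine Finset.sum_congr rfl fun v _ => ?_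
        rw [Matrix.mulVec_smul, Pi.smul_apply, smul_eq_mul]
    _ ≤ ∑ v, γ v * lam := Finset.sum_le_sum fun v _ =>
        mul_le_mul_of_nonneg_left ((le_gauge _ j).trans (hcontr v w hw)) (hγ v)
    _ = lam * F.mulVec (∑ v, γ v • x v) h := by rw [hx, ← Finset.sum_mul, mul_comm]
    _ ≤ _ := mul_le_mul_of_nonneg_left (le_gauge _ h) hlam0.le
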